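/- Let {U_ι}_{ι∈I} be a family of operators U_ι = Op[σ_ι] with |∂_x^α σ_ι(x,ξ)| ≤ A |ξ|^{-1} for |ξ| ≥ 1, |α| ≤ n+1, and let {V_κ}_{κ∈K} be operators V_κ = Op[τ_κ] with |∂_x^α τ_κ(x,ξ)| ≤ B for |ξ| ≥ 1, |α| ≤ n+1. Then the family of products {U_ι V_κ}_{ι∈I, κ∈K} is uniformly compact, i.e. sup_{ι,κ} ‖U_ι V_κ − U_ι V_κ P_N‖ → 0 as N → ∞. -/

import Mathlib

open MeasureTheory Real

noncomputable section

/-- Iterated partial derivative along a list of coordinate directions. -/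
def pderivs {n : ℕ} {E : Type*} [NormedAddCommGroup E] [NormedSpace ℝ E] :
    List (Fin n) → ((Fin n → ℝ) → E) → ((Fin n → ℝ) → E)
  | [], f => f
  | i :: L, f => fun x => fderiv ℝ (pderivs L f) x (Pi.single i 1)

/-- Fourier coefficient in `x ∈ 𝕋ⁿ = [0,1]ⁿ` of a matrix symbol `σ(x,ξ)`. -/
def symbolCoeff {n d : ℕ}
    (σ : (Fin n → ℝ) → (Fin n → ℝ) → ((Fin d → ℂ) →L[ℂ] (Fin d → ℂ)))
    (p : Fin n → ℤ) (ξ : Fin n → ℝ) : (Fin d → ℂ) →L[ℂ] (Fin d → ℂ) :=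
  ∫ x in Set.Icc (0 : Fin n → ℝ) 1,
    Complex.exp (-(2 * π * Complex.I) * (∑ i, (p i : ℝ) * x i)) • σ x ξ

/-- Fourier coefficients of `Op[σ] f`: `(Op[σ] f)^(q) = ∑_{k ≠ 0} σ̂(q − k, k) f̂(k)`. -/
def opCoeff {n d : ℕ}
    (σ : (Fin n → ℝ) → (Fin n → ℝ) → ((Fin d → ℂ) →L[ℂ] (Fin d → ℂ)))
    (f : (Fin n → ℤ) → (Fin d → ℂ)) (q : Fin n → ℤ) : Fin d → ℂ :=
  ∑' k : Fin n → ℤ, if k = 0 then 0 else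
    (symbolCoeff σ (q - k) (fun i => (k i : ℝ))) (f k)


/-- real vector of an integer vector -/
def rc {n : ℕ} (p : Fin n → ℤ) : Fin n → ℝ := fun i => (p i : ℝ)

def wt {n : ℕ} (p : Fin n → ℤ) : ℝ := (1 + ‖rc p‖) ^ (-((n : ℝ) + 1/2))

lemma wt_nonneg {n : ℕ} (p : Fin n → ℤ) : 0 ≤ wt p := by unfold wt; positivity

lemma wt_summable (n : ℕ) : Summable (fun p : Fin n → ℤ => wt p) := by
  let L := Submodule.span ℤ (Set.range (Pi.basisFun ℝ (Fin n)))
  have hmem : ∀ p : Fin n → ℤ, rc p ∈ L := by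
    intro p
    have : rc p = ∑ i, p i • (Pi.basisFun ℝ (Fin n) i) := by
      ext j
      simp [rc, Finset.sum_apply, Pi.single_apply]
    rw [this]
    exact Submodule.sum_mem _ fun i _ =>
      Submodule.smul_mem _ _ (Submodule.subset_span ⟨i, rfl⟩)
  let φ : (Fin n → ℤ) → L := fun p => ⟨rc p, hmem p⟩
  have hφ : Function.Injective φ := by
    intro p q h
    have h1 : rc p = rc q := congrArg Subtype.val h
    ext i
    have := congrFun h1 i
    simpa [rc] using this
  have hr : Module.finrank ℤ L = n := by
    rw [ZLattice.rank ℝ L]; simp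
  have hs := (ZLattice.summable_norm_rpow L (-((n : ℝ) + 1/2)) (by rw [hr]; linarith)).comp_injective hφ
  refine Summable.of_norm_bounded_eventually hs ?_
  have : ∀ᶠ p : Fin n → ℤ in Filter.cofinite, p ≠ 0 := by
    simp [Filter.eventually_cofinite]
  filter_upwards [this] with p hp
  have hpos : 0 < ‖rc p‖ := by
    rw [norm_pos_iff]
    intro h
    apply hp
    ext i
    have := congrFun h i
    simpa [rc] using this
  rw [Real.norm_of_nonneg (wt_nonneg p)]
  change wt p ≤ ‖rc p‖ ^ _
  unfold wt
  exact Real.rpow_le_rpow_of_nonpos hpos (by linarith) (by linarith [(Nat.cast_nonneg n : (0:ℝ) ≤ n)])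

/-- Young's inequality -/
lemma young {G : Type*} [AddCommGroup G] (a f : G → ℝ) (ha : ∀ p, 0 ≤ a p) (hf : ∀ p, 0 ≤ f p)
    (hsa : Summable a) (hsf : Summable fun k => f k ^ 2) :
    (∀ q, Summable fun k => a (q - k) * f k) ∧
    Summable (fun q => (∑' k, a (q - k) * f k) ^ 2) ∧
    ∑' q, (∑' k, a (q - k) * f k) ^ 2 ≤ (∑' p, a p) ^ 2 * ∑' k, f k ^ 2 := by
  have hsub : ∀ q, HasSum (fun k => a (q - k)) (∑' p, a p) := fun q =>
    (Equiv.subLeft q).hasSum_iff (f := a) |>.2 hsa.hasSum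
  have hprod : Summable fun x : G × G => a x.1 * f x.2 ^ 2 :=
    hsa.mul_of_nonneg hsf ha (fun _ => sq_nonneg _)
  let e : G × G ≃ G × G :=
    { toFun := fun x => (x.1 - x.2, x.2)
      invFun := fun x => (x.1 + x.2, x.2)
      left_inv := fun x => by simp
      right_inv := fun x => by simp }
  have hprod2 : Summable fun x : G × G => a (x.1 - x.2) * f x.2 ^ 2 :=
    (e.summable_iff (f := fun x : G × G => a x.1 * f x.2 ^ 2)).2 hprod
  have hin : ∀ q, Summable fun k => a (q - k) * f k ^ 2 := fun q => hprod2.prod_factor q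
  have hcs : ∀ q, (Summable fun k => a (q - k) * f k) ∧
      (∑' k, a (q - k) * f k) ^ 2 ≤ (∑' p, a p) * ∑' k, a (q - k) * f k ^ 2 := by
    intro q
    have key := Real.summable_and_inner_le_Lp_mul_Lq_tsum_of_nonneg (p := 2) (q := 2)
      (f := fun k => √(a (q - k))) (g := fun k => √(a (q - k)) * f k)
      Real.HolderConjugate.two_two (fun k => Real.sqrt_nonneg _)
      (fun k => mul_nonneg (Real.sqrt_nonneg _) (hf k))
      (by simpa [Real.sq_sqrt (ha _)] using (hsub q).summable)
      (by simpa [mul_pow, Real.sq_sqrt (ha _)] using hin q)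
    have e1 : ∀ k, √(a (q - k)) * (√(a (q - k)) * f k) = a (q - k) * f k := fun k => by
      rw [← mul_assoc, Real.mul_self_sqrt (ha _)]
    simp only [e1, Real.rpow_two, mul_pow, Real.sq_sqrt (ha _), (hsub q).tsum_eq] at key
    refine ⟨key.1, ?_⟩
    have h0 : 0 ≤ ∑' k, a (q - k) * f k := tsum_nonneg fun k => mul_nonneg (ha _) (hf _)
    have h1 : 0 ≤ ∑' p, a p := tsum_nonneg ha
    have h2 : 0 ≤ ∑' k, a (q - k) * f k ^ 2 := tsum_nonneg fun k => mul_nonneg (ha _) (sq_nonneg _)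
    rw [← Real.sqrt_eq_rpow, ← Real.sqrt_eq_rpow] at key
    calc _ ≤ (√(∑' p, a p) * √(∑' k, a (q - k) * f k ^ 2)) ^ 2 := pow_le_pow_left₀ h0 key.2 2
      _ = _ := by rw [mul_pow, Real.sq_sqrt h1, Real.sq_sqrt h2]
  have hout : Summable fun q => ∑' k, a (q - k) * f k ^ 2 := hprod2.prod
  have hout2 := hout.mul_left (∑' p, a p)
  have hs2 : Summable (fun q => (∑' k, a (q - k) * f k) ^ 2) :=
    Summable.of_nonneg_of_le (fun _ => sq_nonneg _) (fun q => (hcs q).2) hout2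
  refine ⟨fun q => (hcs q).1, hs2, ?_⟩
  calc _ ≤ ∑' q, (∑' p, a p) * ∑' k, a (q - k) * f k ^ 2 :=
        hs2.tsum_le_tsum (fun q => (hcs q).2) hout2
    _ = (∑' p, a p) * ((∑' p, a p) * ∑' k, f k ^ 2) := by
        rw [tsum_mul_left, ← hprod2.tsum_prod,
          hsa.tsum_mul_tsum hsf hprod]
        congr 1
        exact e.tsum_eq (fun x : G × G => a x.1 * f x.2 ^ 2)
    _ = _ := by ring

/-- integral of a partial derivative of a periodic function vanishes -/
lemma integral_pderiv_periodic {n : ℕ} {E : Type*} [NormedAddCommGroup E] [NormedSpace ℝ E]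
    (G : (Fin n → ℝ) → E) (hG : ContDiff ℝ 1 G)
    (hper : ∀ (x : Fin n → ℝ) (m : Fin n → ℤ), G (x + fun i => (m i : ℝ)) = G x) (i : Fin n) :
    ∫ x in Set.Icc (0 : Fin n → ℝ) 1, fderiv ℝ G x (Pi.single i 1) = 0 := by
  cases n with
  | zero => exact i.elim0
  | succ n =>
  have hcd : Continuous (fderiv ℝ G) := hG.continuous_fderiv (by norm_num)
  have hsum : ∀ x, ∑ j, (if j = i then fderiv ℝ G x else 0) (Pi.single j 1)
      = fderiv ℝ G x (Pi.single i 1) := by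
    intro x
    rw [Finset.sum_eq_single i]
    · simp
    · intro j _ hj; simp [hj]
    · simp
  have key := integral_divergence_of_hasFDerivAt_off_countable' (0 : Fin (n+1) → ℝ) 1
    zero_le_one (fun j => if j = i then G else 0)
    (fun j x => if j = i then fderiv ℝ G x else 0) ∅ Set.countable_empty
    (by
      intro j
      split_ifs
      · exact hG.continuous.continuousOn
      · exact continuousOn_const)
    (by
      intro x _ j
      split_ifs
      · exact (hG.differentiable (by norm_num) x).hasFDerivAt
      · exact hasFDerivAt_const _ _)
    (by
      simp only [hsum]
      exact (Continuous.continuousOn (by fun_prop)).integrableOn_compact isCompact_Icc)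
  simp only [hsum] at key
  rw [key]
  apply Finset.sum_eq_zero
  intro j _
  by_cases hj : j = i
  · subst hj
    simp only [if_true]
    rw [sub_eq_zero]
    congr 1
    ext y
    rw [← hper (Fin.insertNth j ((0 : Fin (n+1) → ℝ) j) y) (Pi.single j 1)]
    congr 1
    ext k
    rcases Fin.eq_self_or_eq_succAbove j k with h | ⟨l, h⟩
    · subst h; simp
    · subst h; simp
  · simp [hj]

/-- exponential character -/
def ech {n : ℕ} (p : Fin n → ℤ) (x : Fin n → ℝ) : ℂ :=
  Complex.exp (-(2 * π * Complex.I) * (∑ i, (p i : ℝ) * x i))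

lemma ech_eq {n : ℕ} (p : Fin n → ℤ) (x : Fin n → ℝ) :
    ech p x = Complex.exp ((∑ i, (-(2 * π * Complex.I) * (p i : ℂ)) •
      (Complex.ofRealCLM.comp (ContinuousLinearMap.proj (R := ℝ) (φ := fun _ : Fin n => ℝ) i))) x) := by
  simp [ech, Finset.mul_sum, mul_assoc]

lemma ech_contDiff {n : ℕ} (p : Fin n → ℤ) : ContDiff ℝ (⊤ : ℕ∞) (ech p) := by
  have : ech p = fun x => _ := funext (ech_eq p)
  rw [this]
  exact (ContinuousLinearMap.contDiff _).cexp

lemma ech_fderiv {n : ℕ} (p : Fin n → ℤ) (x : Fin n → ℝ) (i : Fin n) :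
    fderiv ℝ (ech p) x (Pi.single i 1) = -(2 * π * Complex.I * p i) * ech p x := by
  have : ech p = fun x => _ := funext (ech_eq p)
  rw [this, (ContinuousLinearMap.hasFDerivAt _).cexp.fderiv]
  simp [Pi.single_apply, apply_ite Complex.ofReal]
  ring

lemma ech_per {n : ℕ} (p : Fin n → ℤ) (x : Fin n → ℝ) (m : Fin n → ℤ) :
    ech p (x + fun i => (m i : ℝ)) = ech p x := by
  unfold ech
  rw [Complex.exp_eq_exp_iff_exists_int]
  refine ⟨-∑ i, p i * m i, ?_⟩
  push_cast
  simp only [Pi.add_apply, Complex.ofReal_add, mul_add, Finset.sum_add_distrib]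
  push_cast
  ring

lemma ech_norm {n : ℕ} (p : Fin n → ℤ) (x : Fin n → ℝ) : ‖ech p x‖ = 1 := by
  unfold ech
  rw [Complex.norm_exp]
  simp

section
variable {n : ℕ} {E : Type*} [NormedAddCommGroup E] [NormedSpace ℂ E]

/-- Fourier coefficient -/
def fco (p : Fin n → ℤ) (F : (Fin n → ℝ) → E) : E :=
  ∫ x in Set.Icc (0 : Fin n → ℝ) 1, ech p x • F x

lemma fco_norm_le (p : Fin n → ℤ) (F : (Fin n → ℝ) → E) (M : ℝ) (hM : ∀ x, ‖F x‖ ≤ M) :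
    ‖fco p F‖ ≤ M := by
  have := norm_setIntegral_le_of_norm_le_const (μ := volume) (s := Set.Icc (0 : Fin n → ℝ) 1)
    (f := fun x => ech p x • F x) (C := M) (by simp [Real.volume_Icc_pi])
    (fun x _ => by rw [norm_smul, ech_norm, one_mul]; exact hM x)
  simpa [Measure.real, Real.volume_Icc_pi, fco] using this

lemma fco_pderiv (p : Fin n → ℤ) (F : (Fin n → ℝ) → E) (hF : ContDiff ℝ (⊤ : ℕ∞) F)
    (hper : ∀ (x : Fin n → ℝ) (m : Fin n → ℤ), F (x + fun i => (m i : ℝ)) = F x) (i : Fin n) :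
    fco p (fun x => fderiv ℝ F x (Pi.single i 1)) = (2 * π * Complex.I * p i) • fco p F := by
  have he := ech_contDiff p
  have key := integral_pderiv_periodic (fun x => ech p x • F x)
    ((he.smul hF).of_le (by exact_mod_cast le_top)) (fun x m => by simp only [ech_per, hper]) i
  have h1 : ∀ x, fderiv ℝ (fun x => ech p x • F x) x (Pi.single i 1) =
      ech p x • fderiv ℝ F x (Pi.single i 1) - (2 * π * Complex.I * p i) • (ech p x • F x) := by
    intro x
    have hd := ((he.differentiable (by simp) x).hasFDerivAt.smul
      (hF.differentiable (by simp) x).hasFDerivAt).fderiv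
    have hd' : fderiv ℝ (fun x => ech p x • F x) x = _ := hd
    rw [hd']
    simp [ech_fderiv, smul_smul, sub_eq_add_neg]
  simp only [h1] at key
  have hce := he.continuous
  have hcF := hF.continuous
  have hcd : Continuous (fderiv ℝ F) := hF.continuous_fderiv (by simp)
  rw [integral_sub, integral_smul, sub_eq_zero] at key
  · exact key
  · exact (Continuous.continuousOn (by fun_prop)).integrableOn_compact isCompact_Icc
  · exact (Continuous.continuousOn (by fun_prop)).integrableOn_compact isCompact_Icc

lemma pderivs_smooth_per (F : (Fin n → ℝ) → E) (hF : ContDiff ℝ (⊤ : ℕ∞) F)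
    (hper : ∀ (x : Fin n → ℝ) (m : Fin n → ℤ), F (x + fun i => (m i : ℝ)) = F x)
    (L : List (Fin n)) :
    ContDiff ℝ (⊤ : ℕ∞) (pderivs L F) ∧
    ∀ (x : Fin n → ℝ) (m : Fin n → ℤ), pderivs L F (x + fun i => (m i : ℝ)) = pderivs L F x := by
  induction L with
  | nil => exact ⟨hF, hper⟩
  | cons i L ih =>
    constructor
    · exact (ih.1.fderiv_right (m := (⊤ : ℕ∞)) (by simp)).clm_apply contDiff_const
    · intro x m
      have h2 : (fun y => pderivs L F (y + fun i => (m i : ℝ))) = pderivs L F :=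
        funext fun y => ih.2 y m
      simp only [pderivs]
      rw [← fderiv_comp_add_right, h2]

lemma fco_pderivs (p : Fin n → ℤ) (F : (Fin n → ℝ) → E) (hF : ContDiff ℝ (⊤ : ℕ∞) F)
    (hper : ∀ (x : Fin n → ℝ) (m : Fin n → ℤ), F (x + fun i => (m i : ℝ)) = F x) (i : Fin n)
    (k : ℕ) :
    fco p (pderivs (List.replicate k i) F) = (2 * π * Complex.I * p i) ^ k • fco p F := by
  induction k with
  | zero => simp [pderivs]
  | succ k ih =>
    have := pderivs_smooth_per F hF hper (List.replicate k i)
    rw [List.replicate_succ, pow_succ', mul_smul, ← ih, ← fco_pderiv p _ this.1 this.2 i]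
    rfl

lemma fco_decay (p : Fin n → ℤ) (F : (Fin n → ℝ) → E) (hF : ContDiff ℝ (⊤ : ℕ∞) F)
    (hper : ∀ (x : Fin n → ℝ) (m : Fin n → ℤ), F (x + fun i => (m i : ℝ)) = F x)
    (M : ℝ) (hM : ∀ L : List (Fin n), L.length ≤ n + 1 → ∀ x, ‖pderivs L F x‖ ≤ M) :
    ‖fco p F‖ * (1 + ‖rc p‖) ^ (n + 1) ≤ 2 ^ (n + 1) * M := by
  have hM0 : ‖fco p F‖ ≤ M := fco_norm_le p F M (hM [] (by simp))
  have hMn : 0 ≤ M := (norm_nonneg _).trans hM0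
  by_cases hp : ‖rc p‖ ≤ 1
  · calc _ ≤ M * 2 ^ (n + 1) := by
          gcongr
          linarith
      _ = _ := by ring
  · push Not at hp
    have : ∃ i, ‖rc p i‖ = ‖rc p‖ := by
      have hne : Nonempty (Fin n) := by
        by_contra h
        rw [not_nonempty_iff] at h
        have : rc p = 0 := Subsingleton.elim _ _
        rw [this, norm_zero] at hp
        linarith
      obtain ⟨i, hi⟩ := Finite.exists_max (fun i => ‖rc p i‖)
      exact ⟨i, le_antisymm (norm_le_pi_norm _ i) ((pi_norm_le_iff_of_nonneg (norm_nonneg _)).2 hi)⟩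
    obtain ⟨i, hi⟩ := this
    have h1 := fco_norm_le p _ M (hM (List.replicate (n+1) i) (by simp))
    rw [fco_pderivs p F hF hper, norm_smul, norm_pow] at h1
    have h2 : ‖rc p‖ ≤ ‖(2 * π * Complex.I * p i : ℂ)‖ := by
      have : ‖(2 * π * Complex.I * p i : ℂ)‖ = 2 * π * ‖rc p‖ := by
        rw [← hi]
        simp [rc, abs_of_pos Real.pi_pos]
      rw [this]
      have := Real.pi_gt_three
      nlinarith
    calc ‖fco p F‖ * (1 + ‖rc p‖) ^ (n + 1) ≤ ‖fco p F‖ * (2 * ‖(2 * π * Complex.I * p i : ℂ)‖) ^ (n + 1) := by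
          gcongr; linarith
      _ = 2 ^ (n+1) * (‖(2 * π * Complex.I * p i : ℂ)‖ ^ (n + 1) * ‖fco p F‖) := by rw [mul_pow]; ring
      _ ≤ _ := by gcongr
end

lemma symbolCoeff_eq {n d : ℕ}
    (σ : (Fin n → ℝ) → (Fin n → ℝ) → ((Fin d → ℂ) →L[ℂ] (Fin d → ℂ)))
    (p : Fin n → ℤ) (ξ : Fin n → ℝ) : symbolCoeff σ p ξ = fco p (fun x => σ x ξ) := rfl

lemma rc_norm_ge_one {n : ℕ} {k : Fin n → ℤ} (hk : k ≠ 0) : 1 ≤ ‖rc k‖ := by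
  obtain ⟨i, hi⟩ := Function.ne_iff.1 hk
  refine le_trans ?_ (norm_le_pi_norm (rc k) i)
  have : (1 : ℤ) ≤ |k i| := Int.one_le_abs hi
  simp only [rc, Real.norm_eq_abs]
  exact_mod_cast this

lemma symbolCoeff_bound {n d : ℕ}
    (σ : (Fin n → ℝ) → (Fin n → ℝ) → ((Fin d → ℂ) →L[ℂ] (Fin d → ℂ))) (M : ℝ)
    (ξ : Fin n → ℝ)
    (hper : ∀ (x : Fin n → ℝ) (m : Fin n → ℤ), σ (x + fun i => (m i : ℝ)) ξ = σ x ξ)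
    (hsm : ContDiff ℝ (⊤ : ℕ∞) (fun x => σ x ξ))
    (hbd : ∀ (L : List (Fin n)), L.length ≤ n + 1 →
      ∀ (x : Fin n → ℝ), ‖pderivs L (fun y => σ y ξ) x‖ ≤ M) (p : Fin n → ℤ) :
    ‖symbolCoeff σ p ξ‖ ≤ 2 ^ (n + 1) * M * (wt p / √(1 + ‖rc p‖)) := by
  have h := fco_decay p (fun x => σ x ξ) hsm hper M hbd
  rw [← symbolCoeff_eq] at h
  have hpos : 0 < 1 + ‖rc p‖ := by positivity
  have hw : wt p / √(1 + ‖rc p‖) = ((1 + ‖rc p‖) ^ (n + 1))⁻¹ := by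
    unfold wt
    rw [Real.sqrt_eq_rpow, ← Real.rpow_sub hpos, ← Real.rpow_natCast, ← Real.rpow_neg hpos.le]
    congr 1
    push_cast
    ring
  rw [hw, ← div_eq_mul_inv, le_div_iff₀ (by positivity)]
  exact h

lemma weight_ineq {n : ℕ} (k j : Fin n → ℤ) (hk : k ≠ 0) (N : ℕ) (hj : (N : ℝ) ≤ ‖rc j‖) :
    wt (k - j) / √(1 + ‖rc (k - j)‖) ≤ ‖rc k‖ * (2 / √(1 + N) * wt (k - j)) := by
  have h1 := rc_norm_ge_one hk
  have hw := wt_nonneg (k - j)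
  have htri : ‖rc j‖ ≤ ‖rc k‖ + ‖rc (k - j)‖ := by
    have : rc j = rc k - rc (k - j) := by ext i; simp [rc]
    rw [this]; exact norm_sub_le _ _
  set a := ‖rc k‖
  set b := ‖rc (k - j)‖ with hb
  have hb0 : 0 ≤ b := norm_nonneg _
  have hN : (0:ℝ) ≤ N := Nat.cast_nonneg N
  have h2 : √(1 + N) ≤ 2 * a * √(1 + b) := by
    rw [Real.sqrt_le_left (by positivity), mul_pow, Real.sq_sqrt (by positivity)]
    nlinarith [mul_nonneg (sub_nonneg.2 h1) hb0, mul_nonneg (sub_nonneg.2 h1) (sub_nonneg.2 h1), mul_nonneg hb0 (mul_nonneg (sub_nonneg.2 h1) (sub_nonneg.2 h1))]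
  have hs1 : 0 < √(1 + (N:ℝ)) := Real.sqrt_pos.2 (by positivity)
  have hs2 : 0 < √(1 + b) := Real.sqrt_pos.2 (by positivity)
  have h3 : 1 / √(1 + b) ≤ a * (2 / √(1 + N)) := by
    rw [← mul_div_assoc, div_le_div_iff₀ hs2 hs1]
    linarith
  calc _ = 1 / √(1 + b) * wt (k - j) := by ring
    _ ≤ a * (2 / √(1 + N)) * wt (k - j) := by gcongr
    _ = _ := by ring

/-- Let `U_ι = Op[σ_ι]` with `|∂_x^α σ_ι(x,ξ)| ≤ A |ξ|⁻¹` and `V_κ = Op[τ_κ]`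
with `|∂_x^α τ_κ(x,ξ)| ≤ B`, for `|ξ| ≥ 1` and `|α| ≤ n+1`.  Then the family of products
`{U_ι V_κ}` is uniformly compact: `sup_{ι,κ} ‖U_ι V_κ − U_ι V_κ P_N‖ → 0` as `N → ∞`
(stated as an `L²`-bound on every `f` with Fourier support in `{|k| ≥ N}`). -/
theorem op_products_uniformly_compact (n d : ℕ)
    (I K : Type)
    (σ : I → (Fin n → ℝ) → (Fin n → ℝ) → ((Fin d → ℂ) →L[ℂ] (Fin d → ℂ)))
    (τ : K → (Fin n → ℝ) → (Fin n → ℝ) → ((Fin d → ℂ) →L[ℂ] (Fin d → ℂ)))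
    (A B : ℝ) (hA : 0 < A) (hB : 0 < B)
    (hσper : ∀ ι (x : Fin n → ℝ) (m : Fin n → ℤ) ξ,
      σ ι (x + fun i => (m i : ℝ)) ξ = σ ι x ξ)
    (hτper : ∀ κ (x : Fin n → ℝ) (m : Fin n → ℤ) ξ,
      τ κ (x + fun i => (m i : ℝ)) ξ = τ κ x ξ)
    (hσsmooth : ∀ ι (ξ : Fin n → ℝ), ξ ≠ 0 → ContDiff ℝ (⊤ : ℕ∞) (fun x => σ ι x ξ))
    (hτsmooth : ∀ κ (ξ : Fin n → ℝ), ξ ≠ 0 → ContDiff ℝ (⊤ : ℕ∞) (fun x => τ κ x ξ))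
    (hσbd : ∀ ι (L : List (Fin n)), L.length ≤ n + 1 →
      ∀ (x ξ : Fin n → ℝ), 1 ≤ ‖ξ‖ →
        ‖pderivs L (fun y => σ ι y ξ) x‖ ≤ A * ‖ξ‖⁻¹)
    (hτbd : ∀ κ (L : List (Fin n)), L.length ≤ n + 1 →
      ∀ (x ξ : Fin n → ℝ), 1 ≤ ‖ξ‖ →
        ‖pderivs L (fun y => τ κ y ξ) x‖ ≤ B) :
    ∀ δ : ℝ, 0 < δ → ∃ N₀ : ℕ, ∀ N ≥ N₀, ∀ (ι : I) (κ : K)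
      (f : (Fin n → ℤ) → (Fin d → ℂ)),
        Summable (fun k => ‖f k‖ ^ 2) →
        (∀ k : Fin n → ℤ, ‖(fun i => (k i : ℝ))‖ < (N : ℝ) → f k = 0) →
        Summable (fun q => ‖opCoeff (σ ι) (opCoeff (τ κ) f) q‖ ^ 2) ∧
        (∑' q, ‖opCoeff (σ ι) (opCoeff (τ κ) f) q‖ ^ 2) ≤ δ ^ 2 * ∑' k, ‖f k‖ ^ 2 := by
  intro δ hδ
  set C : ℝ := 2 ^ (n + 1) with hC
  have hCpos : 0 < C := by positivity
  set W : ℝ := ∑' p : Fin n → ℤ, wt p with hW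
  have hW0 : 0 ≤ W := tsum_nonneg wt_nonneg
  obtain ⟨N₀, hN₀⟩ := exists_nat_gt ((2 * C ^ 2 * A * B * W ^ 2) ^ 2 / δ ^ 2)
  refine ⟨N₀, ?_⟩
  intro N hN ι κ f hf hsupp
  obtain ⟨y1, y2, y3⟩ := young (fun p : Fin n → ℤ => wt p) (fun k => ‖f k‖) wt_nonneg
    (fun _ => norm_nonneg _) (wt_summable n) hf
  set S : (Fin n → ℤ) → ℝ := fun q => ∑' k, wt (q - k) * ‖f k‖ with hS
  have hS0 : ∀ q, 0 ≤ S q := fun q =>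
    tsum_nonneg fun k => mul_nonneg (wt_nonneg _) (norm_nonneg _)
  obtain ⟨z1, z2, z3⟩ := young (fun p : Fin n → ℤ => wt p) S wt_nonneg hS0 (wt_summable n) y2
  set T : (Fin n → ℤ) → ℝ := fun q => ∑' k, wt (q - k) * S k with hT
  have hT0 : ∀ q, 0 ≤ T q := fun q =>
    tsum_nonneg fun k => mul_nonneg (wt_nonneg _) (hS0 _)
  have hbτ : ∀ k : Fin n → ℤ, k ≠ 0 → ∀ p, ‖symbolCoeff (τ κ) p (rc k)‖ ≤
      C * B * (wt p / √(1 + ‖rc p‖)) := by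
    intro k hk p
    have h1 := rc_norm_ge_one hk
    have h0 : rc k ≠ 0 := by
      intro h; rw [h, norm_zero] at h1; linarith
    exact symbolCoeff_bound (τ κ) B (rc k) (fun x m => hτper κ x m _) (hτsmooth κ _ h0)
      (fun L hL x => hτbd κ L hL x _ h1) p
  have hbσ : ∀ k : Fin n → ℤ, k ≠ 0 → ∀ p, ‖symbolCoeff (σ ι) p (rc k)‖ ≤
      C * (A * ‖rc k‖⁻¹) * wt p := by
    intro k hk p
    have h1 := rc_norm_ge_one hk
    have h0 : rc k ≠ 0 := by
      intro h; rw [h, norm_zero] at h1; linarith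
    refine (symbolCoeff_bound (σ ι) (A * ‖rc k‖⁻¹) (rc k) (fun x m => hσper ι x m _)
      (hσsmooth ι _ h0) (fun L hL x => hσbd ι L hL x _ h1) p).trans ?_
    have : wt p / √(1 + ‖rc p‖) ≤ wt p := by
      apply div_le_self (wt_nonneg p)
      rw [Real.one_le_sqrt]
      linarith [norm_nonneg (rc p)]
    gcongr
  set D : ℝ := 2 * C * B / √(1 + N) with hD
  have hD0 : 0 ≤ D := by positivity
  have hV : ∀ k : Fin n → ℤ, k ≠ 0 → ‖opCoeff (τ κ) f k‖ ≤ ‖rc k‖ * D * S k := by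
    intro k hk
    unfold opCoeff
    refine tsum_of_norm_bounded ((y1 k).hasSum.mul_left (‖rc k‖ * D)) ?_
    intro j
    have hnn : 0 ≤ ‖rc k‖ * D * (wt (k - j) * ‖f j‖) :=
      mul_nonneg (mul_nonneg (norm_nonneg _) hD0) (mul_nonneg (wt_nonneg _) (norm_nonneg _))
    split_ifs with hj
    · simpa using hnn
    · by_cases hjN : ‖rc j‖ < N
      · rw [hsupp j hjN]; simp
      · push Not at hjN
        have hw := weight_ineq k j hk N hjN
        calc _ ≤ ‖symbolCoeff (τ κ) (k - j) (rc j)‖ * ‖f j‖ := ContinuousLinearMap.le_opNorm _ _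
          _ ≤ C * B * (wt (k - j) / √(1 + ‖rc (k - j)‖)) * ‖f j‖ := by
            gcongr
            exact hbτ j hj _
          _ ≤ C * B * (‖rc k‖ * (2 / √(1 + N) * wt (k - j))) * ‖f j‖ := by gcongr
          _ = _ := by rw [hD]; ring
  have hU : ∀ q, ‖opCoeff (σ ι) (opCoeff (τ κ) f) q‖ ≤ C * A * D * T q := by
    intro q
    rw [opCoeff]
    refine tsum_of_norm_bounded ((z1 q).hasSum.mul_left (C * A * D)) ?_
    intro k
    split_ifs with hk
    · rw [norm_zero]
      exact mul_nonneg (by positivity) (mul_nonneg (wt_nonneg _) (hS0 _))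
    · have h1 := rc_norm_ge_one hk
      have hw := wt_nonneg (q - k)
      calc _ ≤ ‖symbolCoeff (σ ι) (q - k) (rc k)‖ * ‖opCoeff (τ κ) f k‖ :=
            ContinuousLinearMap.le_opNorm _ _
        _ ≤ (C * (A * ‖rc k‖⁻¹) * wt (q - k)) * (‖rc k‖ * D * S k) := by
            gcongr
            · exact hbσ k hk _
            · exact hV k hk
        _ = _ := by
            have : ‖rc k‖ ≠ 0 := by linarith
            field_simp
  have hU2 : ∀ q, ‖opCoeff (σ ι) (opCoeff (τ κ) f) q‖ ^ 2 ≤ (C * A * D) ^ 2 * T q ^ 2 := by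
    intro q
    rw [← mul_pow]
    exact pow_le_pow_left₀ (norm_nonneg _) (hU q) 2
  have hsT := z2.mul_left ((C * A * D) ^ 2)
  have hsum : Summable (fun q => ‖opCoeff (σ ι) (opCoeff (τ κ) f) q‖ ^ 2) :=
    Summable.of_nonneg_of_le (fun _ => sq_nonneg _) hU2 hsT
  refine ⟨hsum, ?_⟩
  have hf0 : 0 ≤ ∑' k, ‖f k‖ ^ 2 := tsum_nonneg fun _ => sq_nonneg _
  have hconst : (C * A * D) ^ 2 * (W ^ 2 * W ^ 2) ≤ δ ^ 2 := by
    have e : (C * A * D) ^ 2 * (W ^ 2 * W ^ 2) = (2 * C ^ 2 * A * B * W ^ 2) ^ 2 / (1 + N) := by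
      have hs : √(1 + (N : ℝ)) ^ 2 = 1 + N := Real.sq_sqrt (by positivity)
      have hD2 : D ^ 2 = (2 * C * B) ^ 2 / (1 + N) := by rw [hD, div_pow, hs]
      rw [mul_pow, hD2]
      ring
    rw [e, div_le_iff₀ (by positivity)]
    rw [div_lt_iff₀ (by positivity)] at hN₀
    have : (N₀ : ℝ) ≤ N := by exact_mod_cast hN
    nlinarith [sq_nonneg δ]
  calc _ ≤ ∑' q, (C * A * D) ^ 2 * T q ^ 2 := hsum.tsum_le_tsum hU2 hsT
    _ = (C * A * D) ^ 2 * ∑' q, T q ^ 2 := tsum_mul_left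
    _ ≤ (C * A * D) ^ 2 * (W ^ 2 * (W ^ 2 * ∑' k, ‖f k‖ ^ 2)) := by
        gcongr
        exact z3.trans (by gcongr)
    _ = (C * A * D) ^ 2 * (W ^ 2 * W ^ 2) * ∑' k, ‖f k‖ ^ 2 := by ring
    _ ≤ _ := by gcongr

end
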